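/- With a supermetric as in the context and A a unital associative ℂ-algebra, let G_{ab} ∈ A (a, b ∈ I), and define G^a_b := Σ_c ε̄^{ac} G_{cb} and G^{ab} := Σ_c ε̄^{bc} G^a_c. Assume: (i) symmetry: G_{ab} = −ε(−1)^{[a][b]+[a]+[b]} G_{ba}; (ii) vanishing supertrace: Σ_a (−1)^{[a]} G^a_a = 0; (iii) the osp supercommutation relations: for all a1, c1, a2, c2, (−1)^{[c1]([a2]+[c2])}·( G^{a1}_{c1} G^{a2}_{c2} − (−1)^{([a1]+[c1])([a2]+[c2])} G^{a2}_{c2} G^{a1}_{c1} ) = ε(−1)^{[c1][c2]} δ^{a2}_{c1} G^{a1}_{c2} − ε(−1)^{[a1][a2]} δ^{a1}_{c2} G^{a2}_{c1} + ε(−1)^{[c2]} ε̄^{a1a2} G_{c2c1} − ε(−1)^{[a2]} ε_{c1c2} G^{a1a2}; (iv) the graded symmetrized super-anticommutator condition: for all a, b, c, d, {G_{bc}, G_{da}} + (−1)^{[d][c]+[d][b]+[b]+[c]}{G_{db}, G_{ca}} + (−1)^{[b][c]+[b][d]+[c]+[d]}{G_{cd}, G_{ba}} = 0, where {G_{pq},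 G_{rs}} := G_{pq}G_{rs} + (−1)^{([p]+[q])([r]+[s])}G_{rs}G_{pq}. Then G obeys the cubic characteristic identity: for all a, b, (G³)^a_b = (ω − 1)·(G²)^a_b + (2 − ω)·G^a_b + (ε/2)·G^a_b·S − (ε/2)·δ^a_b·S, where (G²)^a_b := Σ_c G^a_c G^c_b, (G³)^a_b := Σ_c (G²)^a_c G^c_b, and S := Σ_c (−1)^{[c]} (G²)^c_c. -/

import Mathlib

/-- The sign (−1)^x for a parity x ∈ ZMod 2. -/
noncomputable def sg (x : ZMod 2) : ℂ := if x = 0 then 1 else -1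

@[simp] theorem sg_zero : sg 0 = 1 := by simp [sg]

@[simp] theorem sg_one : sg 1 = -1 := by simp [sg]

theorem zmod_two_cases (x : ZMod 2) : x = 0 ∨ x = 1 := by
  revert x; decide

theorem sg_add (x y : ZMod 2) : sg (x + y) = sg x * sg y := by
  rcases zmod_two_cases x with rfl | rfl <;> rcases zmod_two_cases y with rfl | rfl <;>
    simp [CharTwo.add_self_eq_zero]

theorem sg_mul_self (x : ZMod 2) : sg x * sg x = 1 := by
  rw [← sg_add, CharTwo.add_self_eq_zero, sg_zero]

/-- Generators `G_{ab}` with a supermetric, graded antisymmetry, vanishing supertrace and the osp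
supercommutation relations. -/
structure OspGenerators {n : ℕ} (p : Fin n → ZMod 2) (ε : ℂ) (lo hi : Matrix (Fin n) (Fin n) ℂ)
    {A : Type*} [Ring A] [Algebra ℂ A] (G : Fin n → Fin n → A) : Prop where
  eps : ε = 1 ∨ ε = -1
  lo_zero : ∀ a b, p a + p b ≠ 0 → lo a b = 0
  hi_zero : ∀ a b, p a + p b ≠ 0 → hi a b = 0
  lo_symm : ∀ a b, lo a b = ε * sg (p a * p b) * lo b a
  hi_symm : ∀ a b, hi a b = ε * sg (p a * p b) * hi b a
  hi_lo : ∀ a c, (∑ b, hi a b * lo b c) = if a = c then 1 else 0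
  lo_hi : ∀ a c, (∑ b, lo a b * hi b c) = if a = c then 1 else 0
  symm : ∀ a b, G a b = (-(ε * sg (p a * p b + p a + p b))) • G b a
  str : (∑ a, sg (p a) • ∑ c, hi a c • G c a) = 0
  comm : ∀ a1 c1 a2 c2 : Fin n,
      sg (p c1 * (p a2 + p c2)) •
          ((∑ b, hi a1 b • G b c1) * (∑ b, hi a2 b • G b c2) -
            sg ((p a1 + p c1) * (p a2 + p c2)) •
              ((∑ b, hi a2 b • G b c2) * (∑ b, hi a1 b • G b c1))) =
        (ε * sg (p c1 * p c2) * (if a2 = c1 then 1 else 0)) • (∑ b, hi a1 b • G b c2) -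
          (ε * sg (p a1 * p a2) * (if a1 = c2 then 1 else 0)) • (∑ b, hi a2 b • G b c1) +
          (ε * sg (p c2) * hi a1 a2) • G c2 c1 -
          (ε * sg (p a2) * lo c1 c2) •
            (∑ b, hi a2 b • ∑ b', hi a1 b' • G b' b)

/-- The generators `G^a_b` with the first index raised. -/
noncomputable def raiseLeft {n : ℕ} (hi : Matrix (Fin n) (Fin n) ℂ) {A : Type*} [Ring A]
    [Algebra ℂ A] (G : Fin n → Fin n → A) (a b : Fin n) : A :=
  ∑ c, hi a c • G c b

/-- The generators `G^{ab}` with both indices raised. -/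
noncomputable def raiseBoth {n : ℕ} (hi : Matrix (Fin n) (Fin n) ℂ) {A : Type*} [Ring A]
    [Algebra ℂ A] (G : Fin n → Fin n → A) (a b : Fin n) : A :=
  ∑ c, hi b c • raiseLeft hi G a c

namespace OspGenerators

variable {n : ℕ} {p : Fin n → ZMod 2} {ε : ℂ} {lo hi : Matrix (Fin n) (Fin n) ℂ}
  {A : Type*} [Ring A] [Algebra ℂ A] {G : Fin n → Fin n → A}

theorem parity_eq_of_lo_ne_zero (h : OspGenerators p ε lo hi G) {a b : Fin n} (hab : lo a b ≠ 0) :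
    p a = p b :=
  CharTwo.add_eq_zero.mp (not_not.mp fun hp => hab (h.lo_zero a b hp))

theorem parity_eq_of_hi_ne_zero (h : OspGenerators p ε lo hi G) {a b : Fin n} (hab : hi a b ≠ 0) :
    p a = p b :=
  CharTwo.add_eq_zero.mp (not_not.mp fun hp => hab (h.hi_zero a b hp))

/-- A parity may be transported along the lower metric. -/
theorem lo_smul_congr (h : OspGenerators p ε lo hi G) (a b : Fin n) (f : ZMod 2 → A) :
    lo a b • f (p b) = lo a b • f (p a) := by
  by_cases hab : lo a b = 0
  · simp [hab]
  · rw [h.parity_eq_of_lo_ne_zero hab]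

/-- A parity may be transported along the upper metric. -/
theorem hi_smul_congr (h : OspGenerators p ε lo hi G) (a b : Fin n) (f : ZMod 2 → A) :
    hi a b • f (p b) = hi a b • f (p a) := by
  by_cases hab : hi a b = 0
  · simp [hab]
  · rw [h.parity_eq_of_hi_ne_zero hab]

theorem lo_symm' (h : OspGenerators p ε lo hi G) (a b : Fin n) :
    lo a b = ε * sg (p a) * lo b a := by
  by_cases hab : lo b a = 0
  · rw [h.lo_symm, hab]; simp
  · have hp := h.parity_eq_of_lo_ne_zero hab
    rw [h.lo_symm, hp]
    rcases zmod_two_cases (p a) with ha | ha <;> simp [ha]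

theorem hi_symm' (h : OspGenerators p ε lo hi G) (a b : Fin n) :
    hi a b = ε * sg (p a) * hi b a := by
  by_cases hab : hi b a = 0
  · rw [h.hi_symm, hab]; simp
  · have hp := h.parity_eq_of_hi_ne_zero hab
    rw [h.hi_symm, hp]
    rcases zmod_two_cases (p a) with ha | ha <;> simp [ha]

theorem sum_lo_smul_raiseLeft (h : OspGenerators p ε lo hi G) (x b : Fin n) :
    ∑ a, lo x a • raiseLeft hi G a b = G x b := by
  simp only [raiseLeft, Finset.smul_sum, smul_smul]
  rw [Finset.sum_comm]
  simp only [← Finset.sum_smul, h.lo_hi]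
  simp

theorem sum_lo_smul_raiseBoth (h : OspGenerators p ε lo hi G) (a x : Fin n) :
    ∑ b, lo x b • raiseBoth hi G a b = raiseLeft hi G a x := by
  simp only [raiseBoth, Finset.smul_sum, smul_smul]
  rw [Finset.sum_comm]
  simp only [← Finset.sum_smul, h.lo_hi]
  simp

theorem sum_hi_mul_lo_swap (h : OspGenerators p ε lo hi G) (a x : Fin n) :
    ∑ b, hi a b * lo x b = if a = x then ε * sg (p x) else 0 := by
  simp only [h.lo_symm' x, mul_left_comm _ (ε * sg (p x)), ← Finset.mul_sum, h.hi_lo]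
  simp

/-- Raising the second index of `G_{ab}` agrees with raising the first one up to a sign. -/
theorem sum_hi_smul_right (h : OspGenerators p ε lo hi G) (x y : Fin n) :
    ∑ b, hi y b • G x b = (-(ε * sg (p x * p y + p x + p y))) • raiseLeft hi G y x := by
  rw [raiseLeft, Finset.smul_sum]
  refine Finset.sum_congr rfl fun b _ => ?_
  rw [h.symm x b, h.hi_smul_congr y b fun t => (-(ε * sg (p x * t + p x + t))) • G b x, smul_comm]

theorem raiseBoth_symm (h : OspGenerators p ε lo hi G) (a b : Fin n) :
    raiseBoth hi G a b = (-(ε * sg (p a * p b + p a + p b))) • raiseBoth hi G b a := by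
  have key : raiseBoth hi G a b = ∑ l, hi a l • ∑ c, hi b c • G l c := by
    simp only [raiseBoth, raiseLeft, Finset.smul_sum]
    rw [Finset.sum_comm]
    exact Finset.sum_congr rfl fun _ _ => Finset.sum_congr rfl fun _ _ => smul_comm _ _ _
  rw [key, raiseBoth, Finset.smul_sum]
  refine Finset.sum_congr rfl fun l _ => ?_
  rw [h.sum_hi_smul_right,
    h.hi_smul_congr a l fun t => (-(ε * sg (t * p b + t + p b))) • raiseLeft hi G b l, smul_comm]

theorem sum_sg_smul_raiseLeft (h : OspGenerators p ε lo hi G) :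
    ∑ a, sg (p a) • raiseLeft hi G a a = 0 :=
  h.str

/-- The metric contraction `ω` is the superdimension up to the sign `ε`. -/
theorem sum_hi_mul_lo (h : OspGenerators p ε lo hi G) :
    ∑ a, ∑ b, hi a b * lo a b = ∑ a, ε * sg (p a) := by
  refine Finset.sum_congr rfl fun a _ => ?_
  rw [h.sum_hi_mul_lo_swap, if_pos rfl]

theorem raiseLeft_mul_raiseLeft (h : OspGenerators p ε lo hi G) (x w y z : Fin n) :
    raiseLeft hi G x w * raiseLeft hi G y z =
      sg ((p x + p w) * (p y + p z)) • (raiseLeft hi G y z * raiseLeft hi G x w) +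
      sg (p w * (p y + p z)) •
        ((ε * sg (p w * p z) * (if y = w then 1 else 0)) • raiseLeft hi G x z -
          (ε * sg (p x * p y) * (if x = z then 1 else 0)) • raiseLeft hi G y w +
          (ε * sg (p z) * hi x y) • G z w -
          (ε * sg (p y) * lo w z) • raiseBoth hi G x y) := by
  have := h.comm x w y z
  simp only [raiseBoth, raiseLeft]
  rw [← this, smul_smul, sg_mul_self, one_smul]
  abel

theorem mul_raiseLeft (h : OspGenerators p ε lo hi G) (x w y z : Fin n) :
    G x w * raiseLeft hi G y z =
      sg ((p x + p w) * (p y + p z)) • (raiseLeft hi G y z * G x w) +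
      sg (p w * (p y + p z)) •
        ((ε * sg (p w * p z) * (if y = w then 1 else 0)) • G x z -
          (ε * sg (p x * p y) * lo x z) • raiseLeft hi G y w +
          (ε * sg (p z) * (if x = y then 1 else 0)) • G z w +
          (sg (p x * p y + p x) * lo w z) • raiseLeft hi G y x) := by
  have hB : ∑ a, lo x a • raiseBoth hi G a y =
      (-(ε * sg (p x * p y + p x + p y))) • raiseLeft hi G y x := by
    rw [← h.sum_hi_smul_right]
    simp only [raiseBoth, Finset.smul_sum]
    rw [Finset.sum_comm]
    simp only [smul_comm (lo x _), ← Finset.smul_sum, h.sum_lo_smul_raiseLeft]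
  calc G x w * raiseLeft hi G y z = ∑ a, lo x a • (raiseLeft hi G a w * raiseLeft hi G y z) := by
        rw [← h.sum_lo_smul_raiseLeft x w]
        simp only [Finset.sum_mul, smul_mul_assoc]
    _ = ∑ a, lo x a • (sg ((p x + p w) * (p y + p z)) • (raiseLeft hi G y z * raiseLeft hi G a w) +
          sg (p w * (p y + p z)) •
        ((ε * sg (p w * p z) * (if y = w then 1 else 0)) • raiseLeft hi G a z -
          (ε * sg (p x * p y) * (if a = z then 1 else 0)) • raiseLeft hi G y w +
          (ε * sg (p z) * hi a y) • G z w -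
          (ε * sg (p y) * lo w z) • raiseBoth hi G a y)) := by
        refine Finset.sum_congr rfl fun a _ => ?_
        rw [h.raiseLeft_mul_raiseLeft]
        exact h.lo_smul_congr x a fun t => sg ((t + p w) * (p y + p z)) •
          (raiseLeft hi G y z * raiseLeft hi G a w) + sg (p w * (p y + p z)) •
        ((ε * sg (p w * p z) * (if y = w then 1 else 0)) • raiseLeft hi G a z -
          (ε * sg (t * p y) * (if a = z then 1 else 0)) • raiseLeft hi G y w +
          (ε * sg (p z) * hi a y) • G z w -
          (ε * sg (p y) * lo w z) • raiseBoth hi G a y)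
    _ = sg ((p x + p w) * (p y + p z)) •
          (raiseLeft hi G y z * ∑ a, lo x a • raiseLeft hi G a w) +
          sg (p w * (p y + p z)) •
        ((ε * sg (p w * p z) * (if y = w then 1 else 0)) • (∑ a, lo x a • raiseLeft hi G a z) -
          (ε * sg (p x * p y) * ∑ a, lo x a * (if a = z then 1 else 0)) • raiseLeft hi G y w +
          (ε * sg (p z) * ∑ a, lo x a * hi a y) • G z w -
          (ε * sg (p y) * lo w z) • ∑ a, lo x a • raiseBoth hi G a y) := by
        simp only [Finset.mul_sum, Finset.sum_smul, Finset.smul_sum, ← Finset.sum_add_distrib,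
          ← Finset.sum_sub_distrib, mul_smul_comm]
        refine Finset.sum_congr rfl fun a _ => ?_
        module
    _ = _ := by
        rw [hB]
        simp only [h.sum_lo_smul_raiseLeft, h.lo_hi, smul_smul, mul_ite, mul_one, mul_zero,
          Finset.sum_ite_eq', Finset.mem_univ, if_true, sub_eq_add_neg, ← neg_smul]
        congr 4
        simp only [sg_add]
        have h1 := sg_mul_self (p y)
        have h2 : ε * ε = 1 := by rcases h.eps with e | e <;> simp [e]
        linear_combination (sg (p x * p y) * sg (p x) * lo w z) * (ε * ε * h1 + h2)

theorem mul_lower (h : OspGenerators p ε lo hi G) (x w y z : Fin n) :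
    G x w * G y z =
      sg ((p x + p w) * (p y + p z)) • (G y z * G x w) +
      sg (p w * (p y + p z)) •
        ((ε * sg (p w * p z) * lo y w) • G x z -
          (ε * sg (p x * p y) * lo x z) • G y w +
          (ε * sg (p z) * lo y x) • G z w +
          (sg (p x * p y + p x) * lo w z) • G y x) := by
  let F (t : ZMod 2) (a : Fin n) : A :=
      sg ((p x + p w) * (t + p z)) • (raiseLeft hi G a z * G x w) +
      sg (p w * (t + p z)) •
        ((ε * sg (p w * p z) * (if a = w then 1 else 0)) • G x z -
          (ε * sg (p x * t) * lo x z) • raiseLeft hi G a w +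
          (ε * sg (p z) * (if x = a then 1 else 0)) • G z w +
          (sg (p x * t + p x) * lo w z) • raiseLeft hi G a x)
  calc G x w * G y z = ∑ a, lo y a • (G x w * raiseLeft hi G a z) := by
        rw [← h.sum_lo_smul_raiseLeft y z]
        simp only [Finset.mul_sum, mul_smul_comm]
    _ = ∑ a, lo y a • F (p y) a := by
        refine Finset.sum_congr rfl fun a _ => ?_
        rw [h.mul_raiseLeft]
        exact h.lo_smul_congr y a fun t => F t a
    _ = sg ((p x + p w) * (p y + p z)) • ((∑ a, lo y a • raiseLeft hi G a z) * G x w) +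
      sg (p w * (p y + p z)) •
        ((ε * sg (p w * p z) * ∑ a, lo y a * (if a = w then 1 else 0)) • G x z -
          (ε * sg (p x * p y) * lo x z) • (∑ a, lo y a • raiseLeft hi G a w) +
          (ε * sg (p z) * ∑ a, lo y a * (if x = a then 1 else 0)) • G z w +
          (sg (p x * p y + p x) * lo w z) • ∑ a, lo y a • raiseLeft hi G a x) := by
        simp only [F, Finset.mul_sum, Finset.sum_mul, Finset.sum_smul, Finset.smul_sum,
          ← Finset.sum_add_distrib, ← Finset.sum_sub_distrib, smul_mul_assoc]
        refine Finset.sum_congr rfl fun a _ => ?_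
        module
    _ = _ := by
        simp only [h.sum_lo_smul_raiseLeft, mul_ite, mul_one, mul_zero,
          Finset.sum_ite_eq', Finset.sum_ite_eq, Finset.mem_univ, if_true]

theorem mul_raiseBoth (h : OspGenerators p ε lo hi G) (x w y z : Fin n) :
    G x w * raiseBoth hi G y z =
      sg ((p x + p w) * (p y + p z)) • (raiseBoth hi G y z * G x w) +
      sg (p w * (p y + p z)) •
        (-((sg (p w * p z + p x * p z + p x + p z) * (if y = w then 1 else 0)) •
            raiseLeft hi G z x) -
          (sg (p x * p y + p x) * (if z = x then 1 else 0)) • raiseLeft hi G y w +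
          (ε * sg (p z) * (if x = y then 1 else 0)) • raiseLeft hi G z w +
          (ε * sg (p x * p y + p x + p w) * (if z = w then 1 else 0)) • raiseLeft hi G y x) := by
  let F (t : ZMod 2) (a : Fin n) : A :=
      sg ((p x + p w) * (p y + t)) • (raiseLeft hi G y a * G x w) +
      sg (p w * (p y + t)) •
        ((ε * sg (p w * t) * (if y = w then 1 else 0)) • G x a -
          (ε * sg (p x * p y) * lo x a) • raiseLeft hi G y w +
          (ε * sg t * (if x = y then 1 else 0)) • G a w +
          (sg (p x * p y + p x) * lo w a) • raiseLeft hi G y x)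
  have h2 : ε * ε = 1 := by rcases h.eps with e | e <;> simp [e]
  calc G x w * raiseBoth hi G y z = ∑ a, hi z a • (G x w * raiseLeft hi G y a) := by
        simp only [raiseBoth, Finset.mul_sum, mul_smul_comm]
    _ = ∑ a, hi z a • F (p z) a := by
        refine Finset.sum_congr rfl fun a _ => ?_
        rw [h.mul_raiseLeft]
        exact h.hi_smul_congr z a fun t => F t a
    _ = sg ((p x + p w) * (p y + p z)) • ((∑ a, hi z a • raiseLeft hi G y a) * G x w) +
      sg (p w * (p y + p z)) •
        ((ε * sg (p w * p z) * (if y = w then 1 else 0)) • (∑ a, hi z a • G x a) -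
          (ε * sg (p x * p y) * ∑ a, hi z a * lo x a) • raiseLeft hi G y w +
          (ε * sg (p z) * (if x = y then 1 else 0)) • (∑ a, hi z a • G a w) +
          (sg (p x * p y + p x) * ∑ a, hi z a * lo w a) • raiseLeft hi G y x) := by
        simp only [F, Finset.mul_sum, Finset.sum_mul, Finset.sum_smul, Finset.smul_sum,
          ← Finset.sum_add_distrib, ← Finset.sum_sub_distrib, smul_mul_assoc]
        refine Finset.sum_congr rfl fun a _ => ?_
        module
    _ = _ := by
        have hL : ∑ a, hi z a • G a w = raiseLeft hi G z w := rfl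
        have hB : ∑ a, hi z a • raiseLeft hi G y a = raiseBoth hi G y z := rfl
        simp only [hL, hB, h.sum_hi_smul_right, h.sum_hi_mul_lo_swap, smul_smul, ← neg_smul,
          sub_eq_add_neg]
        have e1 : ε * sg (p w * p z) * (if y = w then 1 else 0) *
            -(ε * sg (p x * p z + p x + p z)) =
            -(sg (p w * p z + p x * p z + p x + p z) * if y = w then 1 else 0) := by
          simp only [sg_add]
          linear_combination (-(sg (p w * p z) * (if y = w then 1 else 0) *
            (sg (p x * p z) * sg (p x) * sg (p z)))) * h2
        have e2 : ε * sg (p x * p y) * (if z = x then ε * sg (p x) else 0) =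
            sg (p x * p y + p x) * if z = x then 1 else 0 := by
          split_ifs
          · simp only [sg_add]
            linear_combination (sg (p x * p y) * sg (p x)) * h2
          · simp
        have e3 : sg (p x * p y + p x) * (if z = w then ε * sg (p w) else 0) =
            ε * sg (p x * p y + p x + p w) * if z = w then 1 else 0 := by
          split_ifs
          · simp only [sg_add]
            ring
          · simp
        rw [e1, e2, e3]

theorem lo_mul_eq_of_parity (h : OspGenerators p ε lo hi G) {a b : Fin n} {x y : ℂ}
    (hxy : p a = p b → x = y) : x * lo a b = y * lo a b := by
  by_cases hab : lo a b = 0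
  · simp [hab]
  · rw [hxy (h.parity_eq_of_lo_ne_zero hab)]

theorem sum_mul_raiseBoth (h : OspGenerators p ε lo hi G) :
    ∑ b, ∑ c, G b c * raiseBoth hi G c b =
      ε • ∑ c, sg (p c) • ∑ b, raiseLeft hi G c b * raiseLeft hi G b c := by
  have hswap (b k : Fin n) : hi b k • G b = (ε * sg (p k)) • hi k b • G b := by
    rw [h.hi_symm' b k, smul_smul]
    congr 1
    by_cases hk : hi k b = 0
    · simp [hk]
    · rw [h.parity_eq_of_hi_ne_zero hk]
  calc ∑ b, ∑ c, G b c * raiseBoth hi G c b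
      = ∑ b, ∑ c, ∑ k, (hi b k • G b) c * raiseLeft hi G c k := by
        simp only [raiseBoth, Finset.mul_sum, mul_smul_comm, smul_mul_assoc, Pi.smul_apply]
    _ = ∑ b, ∑ c, ∑ k, ((ε * sg (p k)) • hi k b • G b) c * raiseLeft hi G c k := by
        simp only [hswap]
    _ = ∑ k, ∑ c, ∑ b, ((ε * sg (p k)) • hi k b • G b) c * raiseLeft hi G c k := by
        rw [Finset.sum_comm]
        simp only [Finset.sum_comm (s := Finset.univ) (t := Finset.univ)
          (f := fun b k => ((ε * sg (p k)) • hi k b • G b) _ * raiseLeft hi G _ k)]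
        rw [Finset.sum_comm]
    _ = _ := by
        simp only [Pi.smul_apply, smul_mul_assoc, mul_smul, Finset.smul_sum]
        refine Finset.sum_congr rfl fun k _ => Finset.sum_congr rfl fun c _ => ?_
        rw [raiseLeft.eq_def hi G k c, Finset.sum_mul, Finset.smul_sum, Finset.smul_sum]
        simp only [smul_mul_assoc]

theorem sum_mul_raiseBoth_mul (h : OspGenerators p ε lo hi G) (e a : Fin n) :
    ∑ b, ∑ c, (ε * sg (p c)) • (G e b * (raiseBoth hi G b c * G c a)) =
      ∑ b, G e b * ∑ c, raiseLeft hi G b c * raiseLeft hi G c a := by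
  refine Finset.sum_congr rfl fun b _ => ?_
  simp only [← mul_smul_comm, ← Finset.mul_sum]
  congr 1
  have hswap (c k : Fin n) : ε * sg (p c) * hi c k = hi k c := by
    rw [h.hi_symm' k c]
    by_cases hk : hi c k = 0
    · simp [hk]
    · rw [h.parity_eq_of_hi_ne_zero hk]
  calc ∑ c, raiseBoth hi G b c * (ε * sg (p c)) • G c a
      = ∑ c, ∑ k, hi k c • (raiseLeft hi G b k * G c a) := by
        refine Finset.sum_congr rfl fun c _ => ?_
        simp only [raiseBoth, Finset.sum_mul]
        refine Finset.sum_congr rfl fun k _ => ?_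
        rw [smul_mul_smul_comm, mul_comm (hi c k), hswap]
    _ = _ := by
        rw [Finset.sum_comm]
        refine Finset.sum_congr rfl fun k _ => ?_
        rw [raiseLeft.eq_def hi G k a, Finset.mul_sum]
        simp only [mul_smul_comm]

/-- Graded transposition of the square of `G`. -/
theorem sq_transpose (h : OspGenerators p ε lo hi G) (e a : Fin n) :
    (ε * sg (p e * p a + p e + p a)) • ∑ b, G a b * raiseLeft hi G b e =
      ∑ b, G e b * raiseLeft hi G b a + (2 - ∑ b, ε * sg (p b)) • G e a := by
  have h2 : ε * ε = 1 := by rcases h.eps with e | e <;> simp [e]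
  have hlead (b : Fin n) : (ε * sg (p e * p a + p e + p a)) •
      sg ((p a + p b) * (p b + p e)) • (raiseLeft hi G b e * G a b) =
      ∑ k, hi k b • (G e k * G b a) := by
    rw [raiseLeft, Finset.sum_mul, Finset.smul_sum, Finset.smul_sum]
    refine Finset.sum_congr rfl fun k _ => ?_
    rw [h.symm k e, h.symm a b, h.hi_symm' b k]
    simp only [smul_mul_smul_comm, smul_smul]
    congr 1
    by_cases hk : hi k b = 0
    · simp [hk]
    · have hp := h.parity_eq_of_hi_ne_zero hk
      rcases h.eps with rfl | rfl <;> rcases zmod_two_cases (p a) with ha | ha <;>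
      rcases zmod_two_cases (p b) with hb | hb <;> rcases zmod_two_cases (p e) with he | he <;>
      simp [hp, ha, hb, he, CharTwo.add_self_eq_zero]
  have hsq : ∑ b, ∑ k, hi k b • (G e k * G b a) = ∑ b, G e b * raiseLeft hi G b a := by
    rw [Finset.sum_comm]
    simp only [raiseLeft, Finset.mul_sum, mul_smul_comm]
  have h1 (b : Fin n) : (ε * sg (p e * p a + p e + p a)) • sg (p b * (p b + p e)) •
      (ε * sg (p b * p e)) • G a e = -((ε * sg (p b)) • G e a) := by
    rw [h.symm a e]
    simp only [smul_smul, ← neg_smul]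
    congr 1
    rcases h.eps with rfl | rfl <;> rcases zmod_two_cases (p a) with ha | ha <;>
    rcases zmod_two_cases (p b) with hb | hb <;> rcases zmod_two_cases (p e) with he | he <;>
    simp [ha, hb, he, CharTwo.add_self_eq_zero]
  have h3 (b : Fin n) : (ε * sg (p e * p a + p e + p a)) • sg (p b * (p b + p e)) •
      (ε * sg (p a * p b) * lo a e) • raiseLeft hi G b b =
      (sg (p a) * lo a e) • sg (p b) • raiseLeft hi G b b := by
    simp only [smul_smul, ← mul_assoc]
    congr 1
    rw [mul_right_comm _ (lo a e)]
    refine h.lo_mul_eq_of_parity fun hp => ?_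
    rcases h.eps with rfl | rfl <;> rcases zmod_two_cases (p e) with he | he <;>
    rcases zmod_two_cases (p b) with hb | hb <;>
    simp [hp, hb, he, CharTwo.add_self_eq_zero]
  have h4 (b : Fin n) : (ε * sg (p e * p a + p e + p a)) • sg (p b * (p b + p e)) •
      (ε * sg (p e) * (if a = b then 1 else 0)) • G e b = if a = b then G e a else 0 := by
    split_ifs with hab
    · subst hab
      simp only [smul_smul]
      convert one_smul ℂ (G e a)
      rcases h.eps with rfl | rfl <;> rcases zmod_two_cases (p a) with ha | ha <;>
      rcases zmod_two_cases (p e) with he | he <;>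
      simp [ha, he, CharTwo.add_self_eq_zero]
    · simp
  have h5 (b : Fin n) : (ε * sg (p e * p a + p e + p a)) • sg (p b * (p b + p e)) •
      (sg (p a * p b + p a) * lo b e) • raiseLeft hi G b a =
      (ε * sg (p e * p a + p e + p a)) • (ε * sg (p e * p a + p a + p e)) • lo e b •
        raiseLeft hi G b a := by
    rw [h.lo_symm' e b]
    simp only [smul_smul, ← mul_assoc]
    congr 1
    refine h.lo_mul_eq_of_parity fun hp => ?_
    rcases h.eps with rfl | rfl <;> rcases zmod_two_cases (p a) with ha | ha <;>
    rcases zmod_two_cases (p e) with he | he <;>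
    simp [hp, ha, he, CharTwo.add_self_eq_zero]
  have h6 : (ε * sg (p e * p a + p e + p a)) * (ε * sg (p e * p a + p a + p e)) = 1 := by
    rw [add_right_comm _ (p a)]
    linear_combination ε * ε * sg_mul_self (p e * p a + p e + p a) + h2
  simp only [Finset.smul_sum, h.mul_raiseLeft a, smul_add, smul_sub, if_true, mul_one,
    hlead, h1, h3, h4, h5,
    Finset.sum_add_distrib, Finset.sum_sub_distrib]
  simp only [← Finset.smul_sum, hsq, h.sum_sg_smul_raiseLeft, h.sum_lo_smul_raiseLeft,
    Finset.sum_neg_distrib, ← Finset.sum_smul, Finset.sum_ite_eq, Finset.mem_univ, if_true,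
    smul_smul _ _ (G e a), h6]
  module

theorem commutator_mul_raiseBoth (h : OspGenerators p ε lo hi G) (a b c e : Fin n) :
    sg ((p b + p c) * (p e + p a)) • (G b c * G e a * raiseBoth hi G c b) =
      G e a * (G b c * raiseBoth hi G c b) +
        (ε * sg (p e * p a + p e + p a)) • (lo e c • (G a b * raiseBoth hi G b c)) -
        lo a b • (G e c * raiseBoth hi G c b) +
        (ε * sg (p e * p a + p e + p a)) • (lo e b • (G a c * raiseBoth hi G c b)) -
        lo a c • (G e b * raiseBoth hi G b c) := by
  have h1 : sg ((p b + p c) * (p e + p a)) • sg (p c * (p e + p a)) •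
      (ε * sg (p c * p a) * lo e c) • (G b a * raiseBoth hi G c b) =
      (ε * sg (p e * p a + p e + p a)) • (lo e c • (G a b * raiseBoth hi G b c)) := by
    rw [h.symm b a, h.raiseBoth_symm c b]
    simp only [smul_mul_smul_comm, smul_smul, ← mul_assoc, mul_right_comm _ (lo e c)]
    congr 1
    refine h.lo_mul_eq_of_parity fun hp => ?_
    rcases h.eps with rfl | rfl <;> rcases zmod_two_cases (p a) with ha | ha <;>
    rcases zmod_two_cases (p b) with hb | hb <;> rcases zmod_two_cases (p c) with hc | hc <;>
    simp [hp, ha, hb, hc, CharTwo.add_self_eq_zero]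
  have h2 : sg ((p b + p c) * (p e + p a)) • sg (p c * (p e + p a)) •
      (ε * sg (p b * p e) * lo b a) • (G e c * raiseBoth hi G c b) =
      lo a b • (G e c * raiseBoth hi G c b) := by
    rw [h.lo_symm' b a, ← one_mul (lo a b)]
    simp only [smul_smul, ← mul_assoc]
    congr 1
    refine h.lo_mul_eq_of_parity fun hp => ?_
    rcases h.eps with rfl | rfl <;> rcases zmod_two_cases (p b) with hb | hb <;>
    rcases zmod_two_cases (p c) with hc | hc <;> rcases zmod_two_cases (p e) with he | he <;>
    simp [hp, hb, hc, he, CharTwo.add_self_eq_zero]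
  have h3 : sg ((p b + p c) * (p e + p a)) • sg (p c * (p e + p a)) •
      (ε * sg (p a) * lo e b) • (G a c * raiseBoth hi G c b) =
      (ε * sg (p e * p a + p e + p a)) • (lo e b • (G a c * raiseBoth hi G c b)) := by
    simp only [smul_smul, ← mul_assoc]
    congr 1
    refine h.lo_mul_eq_of_parity fun hp => ?_
    rcases h.eps with rfl | rfl <;> rcases zmod_two_cases (p a) with ha | ha <;>
    rcases zmod_two_cases (p b) with hb | hb <;> rcases zmod_two_cases (p c) with hc | hc <;>
    simp [hp, ha, hb, hc, CharTwo.add_self_eq_zero]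
  have h4 : sg ((p b + p c) * (p e + p a)) • sg (p c * (p e + p a)) •
      (sg (p b * p e + p b) * lo c a) • (G e b * raiseBoth hi G c b) =
      -(lo a c • (G e b * raiseBoth hi G b c)) := by
    rw [h.raiseBoth_symm c b, h.lo_symm' c a, ← neg_smul, ← neg_one_mul (lo a c)]
    simp only [mul_smul_comm, smul_smul, ← mul_assoc, mul_right_comm _ (lo a c)]
    congr 1
    refine h.lo_mul_eq_of_parity fun hp => ?_
    rcases h.eps with rfl | rfl <;> rcases zmod_two_cases (p b) with hb | hb <;>
    rcases zmod_two_cases (p c) with hc | hc <;> rcases zmod_two_cases (p e) with he | he <;>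
    simp [hp, hb, hc, he, CharTwo.add_self_eq_zero]
  rw [h.mul_lower b c e a]
  simp only [@add_mul A, @sub_mul A, smul_mul_assoc, smul_add, smul_sub, h1, h2, h3, h4,
    @mul_assoc A]
  rw [smul_smul, sg_mul_self, one_smul]
  abel

theorem swap_mul_raiseBoth (h : OspGenerators p ε lo hi G) (a b c e : Fin n) :
    sg (p b + p c + p e * p a + p b * p c + p c * p e + p c * p a) •
        (G c a * G e b * raiseBoth hi G c b) =
      sg ((p b + p c) * (1 + p a)) • (G e b * (G c a * raiseBoth hi G c b)) -
        lo e a • (G c b * raiseBoth hi G b c) -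
        G e a * ((ε * sg (p c)) • lo c b • raiseBoth hi G c b) +
        (ε * sg (p e * p a + p e + p a)) • (lo e c • (G a b * raiseBoth hi G b c)) +
        lo a b • (G e c * raiseBoth hi G c b) := by
  let s := sg (p b + p c + p e * p a + p b * p c + p c * p e + p c * p a)
  change s • _ = _
  have h0 : s •
      sg ((p c + p a) * (p e + p b)) • (G e b * (G c a * raiseBoth hi G c b)) =
      sg ((p b + p c) * (1 + p a)) • (G e b * (G c a * raiseBoth hi G c b)) := by
    rw [smul_smul]
    congr 1
    rcases zmod_two_cases (p a) with ha | ha <;> rcases zmod_two_cases (p b) with hb | hb <;>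
    rcases zmod_two_cases (p c) with hc | hc <;> rcases zmod_two_cases (p e) with he | he <;>
    simp [s, ha, hb, hc, he, CharTwo.add_self_eq_zero]
  have h1 : s •
      sg (p a * (p e + p b)) • (ε * sg (p a * p b) * lo e a) • (G c b * raiseBoth hi G c b) =
      -(lo e a • (G c b * raiseBoth hi G b c)) := by
    rw [h.raiseBoth_symm c b, ← neg_smul, ← neg_one_mul (lo e a)]
    simp only [mul_smul_comm, smul_smul, ← mul_assoc, mul_right_comm _ (lo e a)]
    congr 1
    refine h.lo_mul_eq_of_parity fun hp => ?_
    rcases h.eps with rfl | rfl <;> rcases zmod_two_cases (p a) with ha | ha <;>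
    rcases zmod_two_cases (p b) with hb | hb <;> rcases zmod_two_cases (p c) with hc | hc <;>
    simp [s, hp, ha, hb, hc, CharTwo.add_self_eq_zero]
  have h2 : s •
      sg (p a * (p e + p b)) • (ε * sg (p c * p e) * lo c b) • (G e a * raiseBoth hi G c b) =
      G e a * ((ε * sg (p c)) • lo c b • raiseBoth hi G c b) := by
    simp only [mul_smul_comm, smul_smul, ← mul_assoc]
    congr 1
    refine h.lo_mul_eq_of_parity fun hp => ?_
    rcases h.eps with rfl | rfl <;> rcases zmod_two_cases (p a) with ha | ha <;>
    rcases zmod_two_cases (p b) with hb | hb <;> rcases zmod_two_cases (p e) with he | he <;>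
    simp [s, hp, ha, hb, he, CharTwo.add_self_eq_zero]
  have h3 : s •
      sg (p a * (p e + p b)) • (ε * sg (p b) * lo e c) • (G b a * raiseBoth hi G c b) =
      (ε * sg (p e * p a + p e + p a)) • (lo e c • (G a b * raiseBoth hi G b c)) := by
    rw [h.symm b a, h.raiseBoth_symm c b]
    simp only [smul_mul_smul_comm, smul_smul, ← mul_assoc, mul_right_comm _ (lo e c)]
    congr 1
    refine h.lo_mul_eq_of_parity fun hp => ?_
    rcases h.eps with rfl | rfl <;> rcases zmod_two_cases (p a) with ha | ha <;>
    rcases zmod_two_cases (p b) with hb | hb <;> rcases zmod_two_cases (p c) with hc | hc <;>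
    simp [s, hp, ha, hb, hc, CharTwo.add_self_eq_zero]
  have h4 : s •
      sg (p a * (p e + p b)) • (sg (p c * p e + p c) * lo a b) • (G e c * raiseBoth hi G c b) =
      lo a b • (G e c * raiseBoth hi G c b) := by
    conv_rhs => rw [← one_mul (lo a b)]
    simp only [smul_smul, ← mul_assoc]
    congr 1
    refine h.lo_mul_eq_of_parity fun hp => ?_
    rcases zmod_two_cases (p b) with hb | hb <;>
    rcases zmod_two_cases (p c) with hc | hc <;> rcases zmod_two_cases (p e) with he | he <;>
    simp [s, hp, hb, hc, he, CharTwo.add_self_eq_zero]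
  rw [h.mul_lower c a e b]
  simp only [@add_mul A, @sub_mul A, smul_mul_assoc, smul_add, smul_sub, h1, h2, h3, h4,
    @mul_assoc A, h0]
  abel

theorem mul_mul_raiseBoth (h : OspGenerators p ε lo hi G) (a b c e : Fin n) :
    sg ((p b + p c) * (1 + p a)) • (G e b * (G c a * raiseBoth hi G c b)) =
      -((ε * sg (p c)) • (G e b * (raiseBoth hi G b c * G c a))) -
        (if c = a then G e b * raiseLeft hi G b a else 0) -
        (if b = c then G e b * raiseLeft hi G b a else 0) +
        (ε * sg (p c)) • (G e b * raiseLeft hi G b a) +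
        if b = a then ε • (G e b * (sg (p c) • raiseLeft hi G c c)) else 0 := by
  have h0 : sg ((p b + p c) * (1 + p a)) • sg ((p c + p a) * (p c + p b)) •
      (G e b * (raiseBoth hi G c b * G c a)) =
      -((ε * sg (p c)) • (G e b * (raiseBoth hi G b c * G c a))) := by
    rw [h.raiseBoth_symm c b]
    simp only [smul_mul_assoc, mul_smul_comm, smul_smul, ← neg_smul]
    congr 1
    rcases h.eps with rfl | rfl <;> rcases zmod_two_cases (p a) with ha | ha <;>
    rcases zmod_two_cases (p b) with hb | hb <;> rcases zmod_two_cases (p c) with hc | hc <;>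
    simp [ha, hb, hc, CharTwo.add_self_eq_zero]
  have h1 : sg ((p b + p c) * (1 + p a)) • sg (p a * (p c + p b)) •
      (sg (p a * p b + p c * p b + p c + p b) * (if c = a then 1 else 0)) •
        (G e b * raiseLeft hi G b c) = if c = a then G e b * raiseLeft hi G b a else 0 := by
    split_ifs with hca
    · subst hca
      simp only [smul_smul]
      convert one_smul ℂ (G e b * raiseLeft hi G b c)
      rcases zmod_two_cases (p b) with hb | hb <;> rcases zmod_two_cases (p c) with hc | hc <;>
      simp [hb, hc, CharTwo.add_self_eq_zero]
    · simp
  have h2 : sg ((p b + p c) * (1 + p a)) • sg (p a * (p c + p b)) •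
      (sg (p c * p c + p c) * (if b = c then 1 else 0)) •
        (G e b * raiseLeft hi G c a) = if b = c then G e b * raiseLeft hi G b a else 0 := by
    split_ifs with hbc
    · subst hbc
      simp only [smul_smul]
      convert one_smul ℂ (G e b * raiseLeft hi G b a)
      rcases zmod_two_cases (p a) with ha | ha <;> rcases zmod_two_cases (p b) with hb | hb <;>
      simp [ha, hb, CharTwo.add_self_eq_zero]
    · simp
  have h3 : sg ((p b + p c) * (1 + p a)) • sg (p a * (p c + p b)) •
      (ε * sg (p b)) • (G e b * raiseLeft hi G b a) =
      (ε * sg (p c)) • (G e b * raiseLeft hi G b a) := by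
    simp only [smul_smul]
    congr 1
    rcases zmod_two_cases (p a) with ha | ha <;>
    rcases zmod_two_cases (p b) with hb | hb <;> rcases zmod_two_cases (p c) with hc | hc <;>
    simp [ha, hb, hc, CharTwo.add_self_eq_zero]
  have h4 : sg ((p b + p c) * (1 + p a)) • sg (p a * (p c + p b)) •
      (ε * sg (p c * p c + p c + p a) * (if b = a then 1 else 0)) •
        (G e b * raiseLeft hi G c c) =
      if b = a then ε • (G e b * (sg (p c) • raiseLeft hi G c c)) else 0 := by
    split_ifs with hba
    · subst hba
      simp only [smul_smul, mul_smul_comm]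
      congr 1
      rcases zmod_two_cases (p b) with hb | hb <;> rcases zmod_two_cases (p c) with hc | hc <;>
      simp [hb, hc, CharTwo.add_self_eq_zero]
    · simp
  rw [h.mul_raiseBoth c a c b]
  simp only [@mul_add A, @mul_sub A, @mul_neg A, mul_smul_comm, smul_add, smul_sub, smul_neg,
    if_true, @mul_one ℂ, h0, h1, h2, h3] at h4 ⊢
  simp only [h4]
  abel

theorem sum_lo_smul_mul_raiseBoth (h : OspGenerators p ε lo hi G) (x y : Fin n) :
    ∑ b, ∑ c, lo x c • (G y b * raiseBoth hi G b c) = ∑ b, G y b * raiseLeft hi G b x := by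
  simp only [← h.sum_lo_smul_raiseBoth, Finset.mul_sum, mul_smul_comm]

theorem sum_lo_smul_mul_raiseBoth' (h : OspGenerators p ε lo hi G) (x y : Fin n) :
    ∑ b, lo x b • ∑ c, G y c * raiseBoth hi G c b = ∑ b, G y b * raiseLeft hi G b x := by
  simp only [Finset.smul_sum]
  rw [Finset.sum_comm, h.sum_lo_smul_mul_raiseBoth]

theorem sum_commutator_mul_raiseBoth (h : OspGenerators p ε lo hi G) (a e : Fin n) :
    ∑ b, ∑ c, sg ((p b + p c) * (p e + p a)) • (G b c * G e a * raiseBoth hi G c b) =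
      G e a * ∑ b, ∑ c, G b c * raiseBoth hi G c b +
        (2 * (ε * sg (p e * p a + p e + p a))) • (∑ b, G a b * raiseLeft hi G b e) -
        (2 : ℂ) • ∑ b, G e b * raiseLeft hi G b a := by
  simp only [h.commutator_mul_raiseBoth, Finset.sum_add_distrib, Finset.sum_sub_distrib,
    ← Finset.smul_sum, ← Finset.mul_sum, h.sum_lo_smul_mul_raiseBoth,
    h.sum_lo_smul_mul_raiseBoth']
  module

theorem sum_swap_mul_raiseBoth (h : OspGenerators p ε lo hi G) (a e : Fin n) :
    ∑ b, ∑ c, sg (p b + p c + p e * p a + p b * p c + p c * p e + p c * p a) •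
        (G c a * G e b * raiseBoth hi G c b) =
      ∑ b, ∑ c, sg ((p b + p c) * (1 + p a)) • (G e b * (G c a * raiseBoth hi G c b)) -
        lo e a • (∑ b, ∑ c, G b c * raiseBoth hi G c b) +
        (ε * sg (p e * p a + p e + p a)) • (∑ b, G a b * raiseLeft hi G b e) +
        ∑ b, G e b * raiseLeft hi G b a := by
  have h0 : ∑ b, ∑ c, (ε * sg (p c)) • lo c b • raiseBoth hi G c b = 0 := by
    rw [Finset.sum_comm]
    simp only [← Finset.smul_sum, h.sum_lo_smul_raiseBoth, mul_smul, h.sum_sg_smul_raiseLeft,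
      smul_zero]
  have hS : ∑ b, ∑ c, G c b * raiseBoth hi G b c = ∑ b, ∑ c, G b c * raiseBoth hi G c b :=
    Finset.sum_comm
  simp only [h.swap_mul_raiseBoth, Finset.sum_add_distrib, Finset.sum_sub_distrib,
    ← Finset.smul_sum, ← Finset.mul_sum, h.sum_lo_smul_mul_raiseBoth,
    h.sum_lo_smul_mul_raiseBoth', h0, hS]
  simp only [mul_zero, sub_zero]

theorem sum_mul_mul_raiseBoth (h : OspGenerators p ε lo hi G) (a e : Fin n) :
    ∑ b, ∑ c, sg ((p b + p c) * (1 + p a)) • (G e b * (G c a * raiseBoth hi G c b)) =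
      -(∑ b, G e b * ∑ c, raiseLeft hi G b c * raiseLeft hi G c a) +
        ((∑ c, ε * sg (p c)) - 2) • ∑ b, G e b * raiseLeft hi G b a := by
  have h4 : ∑ b, ∑ c, (if b = a then ε • (G e b * (sg (p c) • raiseLeft hi G c c)) else 0) = 0 := by
    refine Finset.sum_eq_zero fun b _ => ?_
    split_ifs
    · rw [← Finset.smul_sum, ← Finset.mul_sum, h.sum_sg_smul_raiseLeft, mul_zero, smul_zero]
    · simp
  have h3 : ∑ b, ∑ c, (ε * sg (p c)) • (G e b * raiseLeft hi G b a) =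
      (∑ c, ε * sg (p c)) • ∑ b, G e b * raiseLeft hi G b a := by
    simp only [← Finset.sum_smul, ← Finset.smul_sum]
  simp only [h.mul_mul_raiseBoth, Finset.sum_add_distrib, Finset.sum_sub_distrib,
    Finset.sum_neg_distrib, h.sum_mul_raiseBoth_mul, h3, h4, Finset.sum_ite_eq,
    Finset.sum_ite_eq', Finset.mem_univ, if_true]
  module

/-- The cubic characteristic identity with both free indices lowered. -/
theorem cubic_lower (h : OspGenerators p ε lo hi G)
    (hanti : ∀ a b c e : Fin n,
      (G b c * G e a + sg ((p b + p c) * (p e + p a)) • (G e a * G b c)) +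
        sg (p e * p c + p e * p b + p b + p c) •
          (G e b * G c a + sg ((p e + p b) * (p c + p a)) • (G c a * G e b)) +
        sg (p b * p c + p b * p e + p c + p e) •
          (G c e * G b a + sg ((p c + p e) * (p b + p a)) • (G b a * G c e)) = 0)
    (e a : Fin n) :
    ∑ b, G e b * ∑ c, raiseLeft hi G b c * raiseLeft hi G c a =
      ((∑ c, ε * sg (p c)) - 1) • (∑ b, G e b * raiseLeft hi G b a) +
        (2 - ∑ c, ε * sg (p c)) • G e a +
        (ε / 2) • (G e a * ∑ c, sg (p c) • ∑ b, raiseLeft hi G c b * raiseLeft hi G b c) -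
        (ε / 2) • lo e a • ∑ c, sg (p c) • ∑ b, raiseLeft hi G c b * raiseLeft hi G b c := by
  let T (b c : Fin n) : A :=
    sg ((p b + p c) * (1 + p a)) • (G e b * (G c a * raiseBoth hi G c b)) +
      sg (p b + p c + p e * p a + p b * p c + p c * p e + p c * p a) •
        (G c a * G e b * raiseBoth hi G c b)
  have hpt (b c : Fin n) :
      sg ((p b + p c) * (p e + p a)) • (G b c * G e a * raiseBoth hi G c b) +
        G e a * (G b c * raiseBoth hi G c b) + T b c + T c b = 0 := by
    have h1 : sg ((p b + p c) * (p e + p a)) • sg ((p b + p c) * (p e + p a)) •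
        (G e a * (G b c * raiseBoth hi G c b)) = G e a * (G b c * raiseBoth hi G c b) := by
      rw [smul_smul, sg_mul_self, one_smul]
    have h2 : sg ((p b + p c) * (p e + p a)) • sg (p e * p c + p e * p b + p b + p c) •
        (G e b * (G c a * raiseBoth hi G c b)) =
        sg ((p b + p c) * (1 + p a)) • (G e b * (G c a * raiseBoth hi G c b)) := by
      simp only [smul_smul]
      congr 1
      rcases zmod_two_cases (p a) with ha | ha <;> rcases zmod_two_cases (p b) with hb | hb <;>
      rcases zmod_two_cases (p c) with hc | hc <;> rcases zmod_two_cases (p e) with he | he <;>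
      simp [ha, hb, hc, he, CharTwo.add_self_eq_zero]
    have h3 : sg ((p b + p c) * (p e + p a)) • sg (p e * p c + p e * p b + p b + p c) •
        sg ((p e + p b) * (p c + p a)) • (G c a * (G e b * raiseBoth hi G c b)) =
        sg (p b + p c + p e * p a + p b * p c + p c * p e + p c * p a) •
          (G c a * (G e b * raiseBoth hi G c b)) := by
      simp only [smul_smul]
      congr 1
      rcases zmod_two_cases (p a) with ha | ha <;> rcases zmod_two_cases (p b) with hb | hb <;>
      rcases zmod_two_cases (p c) with hc | hc <;> rcases zmod_two_cases (p e) with he | he <;>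
      simp [ha, hb, hc, he, CharTwo.add_self_eq_zero]
    have h4 : sg ((p b + p c) * (p e + p a)) • sg (p b * p c + p b * p e + p c + p e) •
        (G c e * (G b a * raiseBoth hi G c b)) =
        sg ((p c + p b) * (1 + p a)) • (G e c * (G b a * raiseBoth hi G b c)) := by
      rw [h.symm c e, h.raiseBoth_symm c b]
      simp only [smul_mul_assoc, mul_smul_comm, smul_smul]
      congr 1
      rcases h.eps with rfl | rfl <;> rcases zmod_two_cases (p a) with ha | ha <;>
      rcases zmod_two_cases (p b) with hb | hb <;> rcases zmod_two_cases (p c) with hc | hc <;>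
      rcases zmod_two_cases (p e) with he | he <;>
      simp [ha, hb, hc, he, CharTwo.add_self_eq_zero]
    have h5 : sg ((p b + p c) * (p e + p a)) • sg (p b * p c + p b * p e + p c + p e) •
        sg ((p c + p e) * (p b + p a)) • (G b a * (G c e * raiseBoth hi G c b)) =
        sg (p c + p b + p e * p a + p c * p b + p b * p e + p b * p a) •
          (G b a * (G e c * raiseBoth hi G b c)) := by
      rw [h.symm c e, h.raiseBoth_symm c b]
      simp only [smul_mul_assoc, mul_smul_comm, smul_smul]
      congr 1
      rcases h.eps with rfl | rfl <;> rcases zmod_two_cases (p a) with ha | ha <;>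
      rcases zmod_two_cases (p b) with hb | hb <;> rcases zmod_two_cases (p c) with hc | hc <;>
      rcases zmod_two_cases (p e) with he | he <;>
      simp [ha, hb, hc, he, CharTwo.add_self_eq_zero]
    have key := congrArg (fun x => sg ((p b + p c) * (p e + p a)) • (x * raiseBoth hi G c b))
      (hanti a b c e)
    simp only [@add_mul A, smul_mul_assoc, smul_add, zero_mul, smul_zero, @mul_assoc A, h1, h2, h3,
      h4, h5] at key
    rw [← key]
    simp only [T, @mul_assoc A]
  have hT : ∑ b, ∑ c, T c b = ∑ b, ∑ c, T b c := Finset.sum_comm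
  have hsum : ∑ b, ∑ c, (sg ((p b + p c) * (p e + p a)) • (G b c * G e a * raiseBoth hi G c b) +
        G e a * (G b c * raiseBoth hi G c b) + T b c + T c b) = 0 := by
    simp only [hpt, Finset.sum_const_zero]
  have hTsum : ∑ b, ∑ c, T b c =
      (∑ b, ∑ c, sg ((p b + p c) * (1 + p a)) • (G e b * (G c a * raiseBoth hi G c b))) +
      ∑ b, ∑ c, sg (p b + p c + p e * p a + p b * p c + p c * p e + p c * p a) •
        (G c a * G e b * raiseBoth hi G c b) := by
    simp only [T, Finset.sum_add_distrib]
  simp only [Finset.sum_add_distrib, hT, h.sum_commutator_mul_raiseBoth, ← Finset.mul_sum] at hsum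
  rw [hTsum, h.sum_swap_mul_raiseBoth, h.sum_mul_mul_raiseBoth, mul_smul,
    h.sq_transpose, h.sum_mul_raiseBoth, mul_smul_comm] at hsum
  linear_combination (norm := module) (-(1 / 4 : ℂ)) • hsum

end OspGenerators

/-- If osp generators G_{ab} are graded-antisymmetric, supertraceless, satisfy the osp
supercommutation relations and the graded symmetrized super-anticommutator condition,
then they obey the cubic characteristic identity. -/
theorem anticommutator_condition_implies_cubic_identity
    (n : ℕ) (p : Fin n → ZMod 2) (ε : ℂ) (hε : ε = 1 ∨ ε = -1)
    (εlo εhi : Matrix (Fin n) (Fin n) ℂ)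
    (hlo0 : ∀ a b, p a + p b ≠ 0 → εlo a b = 0)
    (hhi0 : ∀ a b, p a + p b ≠ 0 → εhi a b = 0)
    (hlosym : ∀ a b, εlo a b = ε * sg (p a * p b) * εlo b a)
    (hhisym : ∀ a b, εhi a b = ε * sg (p a * p b) * εhi b a)
    (hinv1 : ∀ a c, (∑ b, εhi a b * εlo b c) = if a = c then 1 else 0)
    (hinv2 : ∀ a c, (∑ b, εlo a b * εhi b c) = if a = c then 1 else 0)
    (A : Type*) [Ring A] [Algebra ℂ A]
    (Glo : Fin n → Fin n → A)
    -- (i) graded antisymmetry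
    (hsym : ∀ a b, Glo a b = (-(ε * sg (p a * p b + p a + p b))) • Glo b a)
    -- (ii) vanishing supertrace
    (htr : (∑ a, sg (p a) • ∑ cc, εhi a cc • Glo cc a) = 0)
    -- (iii) osp supercommutation relations
    (hcomm : ∀ a1 c1 a2 c2 : Fin n,
      sg (p c1 * (p a2 + p c2)) •
          ((∑ b, εhi a1 b • Glo b c1) * (∑ b, εhi a2 b • Glo b c2) -
            sg ((p a1 + p c1) * (p a2 + p c2)) •
              ((∑ b, εhi a2 b • Glo b c2) * (∑ b, εhi a1 b • Glo b c1))) =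
        (ε * sg (p c1 * p c2) * (if a2 = c1 then 1 else 0)) • (∑ b, εhi a1 b • Glo b c2) -
          (ε * sg (p a1 * p a2) * (if a1 = c2 then 1 else 0)) • (∑ b, εhi a2 b • Glo b c1) +
          (ε * sg (p c2) * εhi a1 a2) • Glo c2 c1 -
          (ε * sg (p a2) * εlo c1 c2) •
            (∑ b, εhi a2 b • ∑ b', εhi a1 b' • Glo b' b))
    -- (iv) graded symmetrized super-anticommutator condition
    (hanti : ∀ a b c e : Fin n,
      (Glo b c * Glo e a + sg ((p b + p c) * (p e + p a)) • (Glo e a * Glo b c)) +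
        sg (p e * p c + p e * p b + p b + p c) •
          (Glo e b * Glo c a + sg ((p e + p b) * (p c + p a)) • (Glo c a * Glo e b)) +
        sg (p b * p c + p b * p e + p c + p e) •
          (Glo c e * Glo b a + sg ((p c + p e) * (p b + p a)) • (Glo b a * Glo c e)) = 0) :
    let Gup : Fin n → Fin n → A := fun a b => ∑ cc, εhi a cc • Glo cc b
    let G2 : Fin n → Fin n → A := fun a b => ∑ cc, Gup a cc * Gup cc b
    let G3 : Fin n → Fin n → A := fun a b => ∑ cc, G2 a cc * Gup cc b
    let ω : ℂ := ∑ a, ∑ b, εhi a b * εlo a b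
    let S : A := ∑ cc, sg (p cc) • G2 cc cc
    ∀ a b : Fin n,
      G3 a b = (ω - 1) • G2 a b + (2 - ω) • Gup a b + (ε / 2) • (Gup a b * S) -
        (ε / 2) • (if a = b then S else 0) := by
  intro Gup G2 G3 ω S a b
  have h : OspGenerators p ε εlo εhi Glo :=
    ⟨hε, hlo0, hhi0, hlosym, hhisym, hinv1, hinv2, hsym, htr, hcomm⟩
  have hω : ω = ∑ c, ε * sg (p c) := h.sum_hi_mul_lo
  have hraise (F : Fin n → A) : ∑ e, εhi a e • ∑ c, Glo e c * F c = ∑ c, Gup a c * F c := by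
    simp only [Gup, Finset.smul_sum, Finset.sum_mul, smul_mul_assoc]
    exact Finset.sum_comm
  have hG3 : G3 a b = ∑ e, εhi a e • ∑ c, Glo e c * ∑ d, Gup c d * Gup d b := by
    rw [hraise]
    simp only [G3, G2, Finset.sum_mul, Finset.mul_sum, mul_assoc]
    exact Finset.sum_comm
  have hG2 : ∑ e, εhi a e • ∑ c, Glo e c * Gup c b = G2 a b := hraise fun c => Gup c b
  have hG : ∑ e, εhi a e • Glo e b = Gup a b := rfl
  have hGS : ∑ e, εhi a e • (Glo e b * S) = Gup a b * S := by
    simp only [Gup, Finset.sum_mul, smul_mul_assoc]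
  have hS : ∑ e, εhi a e • εlo e b • S = if a = b then S else 0 := by
    simp only [smul_smul, ← Finset.sum_smul, hinv1, ite_smul, one_smul, zero_smul]
  have hcubic (e : Fin n) : ∑ c, Glo e c * ∑ d, Gup c d * Gup d b =
      (ω - 1) • (∑ c, Glo e c * Gup c b) + (2 - ω) • Glo e b + (ε / 2) • (Glo e b * S) -
        (ε / 2) • εlo e b • S := by
    rw [hω]
    exact h.cubic_lower hanti e b
  rw [hG3, ← hG2, ← hG, ← hGS, ← hS]
  simp only [hcubic, smul_add, smul_sub, Finset.sum_add_distrib, Finset.sum_sub_distrib,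
    smul_comm (εhi a _) (ω - 1), smul_comm (εhi a _) (2 - ω), smul_comm (εhi a _) (ε / 2),
    ← Finset.smul_sum]
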